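/- If the Star STS instance is a YES instance, then the constructed token swapping instance has a swap sequence of length at most K = H + n that transforms the initial token placement into the target token placement. -/

import Mathlib

namespace UnweightedTS

/-- Vertices of the constructed tree: the root, ordering-gadget vertices `ord d`
(distance `d+1` from the root), slot-gadget path vertices `slot i d` (distance `d+1`
from the root in slot gadget `i`), and nooks.  (Coordinates range over all of `ℕ`;
the graph below only has edges between the vertices of the construction, so the
remaining vertices are isolated and carry no tokens.) -/
inductive Vtx (m : ℕ) where
  | root : Vtx m
  | ord : ℕ → Vtx m
  | slot : Fin m → ℕ → Vtx m
  | nook : Fin m → Vtx m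
deriving DecidableEq

/-- Adjacency generator for the tree: `len i` = length of the path of slot gadget `i`,
`lenOrd` = length of the ordering path, `nd` = distance from the root of the path
vertex to which the nook of each slot gadget is attached. -/
def rel {m : ℕ} (len : Fin m → ℕ) (lenOrd nd : ℕ) : Vtx m → Vtx m → Prop
  | .root, .ord d => d = 0 ∧ 0 < lenOrd
  | .ord d, .ord d' => d' = d + 1 ∧ d' < lenOrd
  | .root, .slot i d => d = 0 ∧ 0 < len i
  | .slot i d, .slot i' d' => i = i' ∧ d' = d + 1 ∧ d' < len i
  | .slot i d, .nook i' => i = i' ∧ d + 1 = nd ∧ d < len i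
  | _, _ => False

/-- The constructed tree, as a simple graph. -/
def Tree {m : ℕ} (len : Fin m → ℕ) (lenOrd nd : ℕ) : SimpleGraph (Vtx m) :=
  SimpleGraph.fromRel (rel len lenOrd nd)

/-- Swap the two values `e.1`, `e.2`. -/
def swapV {V : Type*} [DecidableEq V] (e : V × V) (v : V) : V :=
  if v = e.1 then e.2 else if v = e.2 then e.1 else v

/-- Apply a sequence of swaps to a token placement (token ↦ vertex). -/
def applySwaps {T V : Type*} [DecidableEq V] (σ : List (V × V)) (f : T → V) : T → V :=
  σ.foldl (fun g e => fun t => swapV e (g t)) f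

/-- Apply a sequence of star swaps (each given by a leaf) to a placement on the star
with center `none` and leaves `some l`. -/
def starApply {L : Type*} [DecidableEq L] (σ : List L) (f : Option L → Option L) :
    Option L → Option L :=
  σ.foldl (fun g l => fun t => swapV ((none : Option L), some l) (g t)) f

/-- The Star STS instance is a YES instance. -/
def StarSTSYes {L : Type*} [DecidableEq L] (π : Equiv.Perm (Option L)) (σ : List L) : Prop :=
  ∃ σ' : List L, σ'.Sublist σ ∧ starApply σ' id = ⇑π

/-- `k = (mn)^25`, the length of a big segment. -/
def kk (m n : ℕ) : ℕ := (m * n) ^ 25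

/-- `k' = k / n^8`, the length of a padding segment. -/
def kk' (m n : ℕ) : ℕ := kk m n / n ^ 8

variable {m n : ℕ}

/-- `nᵢ`: the number of occurrences of slot `i` in the swap sequence. -/
def cnt (s : Fin n → Fin m) (i : Fin m) : ℕ :=
  (Finset.univ.filter fun j : Fin n => s j = i).card

/-- Length of the ordering path: `nk + nmk'`. -/
def lenOrd (m n : ℕ) : ℕ := n * kk m n + n * m * kk' m n

/-- Length of the path of slot gadget `i`: `nᵢ k + n k'`. -/
def lenSlot (s : Fin n → Fin m) (i : Fin m) : ℕ := cnt s i * kk m n + n * kk' m n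

/-- The non-item tokens: big segments `xⱼ`, `yⱼ` of `k` tokens each, and padding
segments `p_{i,j}`, `q_{i,j}` of `k'` tokens each (in this order of the sum). -/
abbrev NonItem (m n : ℕ) :=
  (Fin n × Fin (kk m n)) ⊕ (Fin n × Fin (kk m n)) ⊕
    (Fin m × Fin n × Fin (kk' m n)) ⊕ (Fin m × Fin n × Fin (kk' m n))

/-- All tokens: item tokens (`Option (Fin m)`, `none` = item 0) and the non-item
tokens. -/
abbrev Tok (m n : ℕ) := Option (Fin m) ⊕ NonItem m n

/-- The constructed tree: ordering path of length `nk + nmk'`, slot path `i` of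
length `nᵢk + nk'`, nooks attached at distance `k` from the root. -/
def TheGraph (s : Fin n → Fin m) : SimpleGraph (Vtx m) :=
  Tree (lenSlot s) (lenOrd m n) (kk m n)

/-- The distance from the root, in slot gadget `i`, at which the block of segment
`q_{i,j}` (preceded by `yⱼ` when `s j = i`) starts in the initial configuration. -/
def offQ (s : Fin n → Fin m) (i : Fin m) (j : Fin n) : ℕ :=
  ∑ j' ∈ Finset.univ.filter (fun j' : Fin n => j'.val < j.val),
    (kk' m n + if s j' = i then kk m n else 0)

/-- The slot occurring next after position `j` in the swap sequence, if any. -/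
def nxt (s : Fin n → Fin m) (j : Fin n) : Option (Fin m) :=
  if h : j.val + 1 < n then some (s ⟨j.val + 1, h⟩) else none

/-- The rank (`0`-based position) of the padding segment `q_{i,j}` among the `m`
padding segments following `yⱼ` in the target configuration of the ordering gadget:
`q_{s_{j+1},j}` first, `q_{s_j,j}` last, and the others in increasing order of `i`. -/
def rho (s : Fin n → Fin m) (i : Fin m) (j : Fin n) : ℕ :=
  if some i = nxt s j then 0
  else if i = s j then m - 1
  else (if (nxt s j).isSome then 1 else 0) +
    (Finset.univ.filter fun i' : Fin m =>
      i'.val < i.val ∧ i' ≠ s j ∧ some i' ≠ nxt s j).card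

/-- The distance from the root, in slot gadget `i`, at which the block of segment
`p_{i,j}` (followed by `xⱼ` when `s j = i`) starts in the target configuration. -/
def tOffP (s : Fin n → Fin m) (i : Fin m) (j : Fin n) : ℕ :=
  ∑ j' ∈ Finset.univ.filter (fun j' : Fin n => j.val < j'.val),
    (kk' m n + if s j' = i then kk m n else 0)

/-- The initial placement of the tokens.  Item `0` is at the root and item `i` at the
nook of slot gadget `i`.  The ordering gadget contains, from the root outward, the
blocks `x₁, p_{·,1}, x₂, p_{·,2}, …, xₙ, p_{·,n}` (the `m` padding blocks after `xⱼ`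
ordered by `rho`); slot gadget `i` contains, from the root outward, the blocks
`q_{i,1},…,q_{i,n}` with `yⱼ` inserted immediately on the root side of `q_{i,j}`
whenever `s j = i`.  Within a segment the coordinate `a` increases away from the root
in slot gadgets and away from the root in the ordering gadget. -/
def initTok (s : Fin n → Fin m) : Tok m n → Vtx m
  | Sum.inl none => .root
  | Sum.inl (some i) => .nook i
  | Sum.inr (Sum.inl (j, a)) => .ord (j.val * (kk m n + m * kk' m n) + a.val)
  | Sum.inr (Sum.inr (Sum.inl (j, a))) => .slot (s j) (offQ s (s j) j + a.val)
  | Sum.inr (Sum.inr (Sum.inr (Sum.inl (i, j, a)))) =>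
      .ord (j.val * (kk m n + m * kk' m n) + kk m n + rho s i j * kk' m n + a.val)
  | Sum.inr (Sum.inr (Sum.inr (Sum.inr (i, j, a)))) =>
      .slot i (offQ s i j + (if s j = i then kk m n else 0) + a.val)

/-- The target placement of the tokens.  Item `o` goes to the position of item `π o`;
the ordering gadget contains, from its far end toward the root, the blocks
`y₁, q_{·,1}, y₂, q_{·,2}, …, yₙ, q_{·,n}` (the `m` padding blocks after `yⱼ` ordered
by `rho`); slot gadget `i` contains, from the root outward, the blocks
`p_{i,n},…,p_{i,1}` with `xⱼ` inserted immediately after (away from the root)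
`p_{i,j}` whenever `s j = i`.  The left-to-right order of the tokens within each
segment is the same as in the initial configuration. -/
def tgtTok (s : Fin n → Fin m) (π : Equiv.Perm (Option (Fin m))) : Tok m n → Vtx m
  | Sum.inl o => (match π o with | none => .root | some i => .nook i)
  | Sum.inr (Sum.inl (j, a)) =>
      .slot (s j) (tOffP s (s j) j + kk' m n + (kk m n - 1 - a.val))
  | Sum.inr (Sum.inr (Sum.inl (j, a))) =>
      .ord (lenOrd m n - 1 - (j.val * (kk m n + m * kk' m n) + a.val))
  | Sum.inr (Sum.inr (Sum.inr (Sum.inl (i, j, a)))) =>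
      .slot i (tOffP s i j + (kk' m n - 1 - a.val))
  | Sum.inr (Sum.inr (Sum.inr (Sum.inr (i, j, a)))) =>
      .ord (lenOrd m n - 1 -
        (j.val * (kk m n + m * kk' m n) + kk m n + rho s i j * kk' m n + a.val))

/-- `d_t`: the tree distance between token `t`'s initial and target vertices. -/
noncomputable def dd (s : Fin n → Fin m) (π : Equiv.Perm (Option (Fin m)))
    (t : Tok m n) : ℕ :=
  (TheGraph s).dist (initTok s t) (tgtTok s π t)

end UnweightedTS

namespace UnweightedTS


/-! ### Running swaps on vertices -/

def run {V : Type*} [DecidableEq V] (σ : List (V × V)) (v : V) : V :=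
  σ.foldl (fun w e => swapV e w) v

theorem applySwaps_eq {T V : Type*} [DecidableEq V] (σ : List (V × V)) (f : T → V) :
    applySwaps σ f = fun t => run σ (f t) := by
  induction σ generalizing f with
  | nil => rfl
  | cons e σ ih =>
    have := ih (fun t => swapV e (f t))
    simpa [applySwaps, run] using this

theorem run_append {V : Type*} [DecidableEq V] (σ τ : List (V × V)) (v : V) :
    run (σ ++ τ) v = run τ (run σ v) := by
  simp [run, List.foldl_append]

theorem run_single {V : Type*} [DecidableEq V] (e : V × V) (v : V) :
    run [e] v = swapV e v := rfl

/-- a token moves down from the root to depth `h` of slot `i`. -/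
def Dm (i : Fin m) (h : ℕ) : Vtx m → Vtx m
  | .root => if h = 0 then .root else .slot i (h - 1)
  | .slot i' d => if i' = i ∧ d < h then (if d = 0 then .root else .slot i' (d - 1))
      else .slot i' d
  | v => v

/-- a token moves from `ord 0` to `ord (M-1)`. -/
def Ym (M : ℕ) : Vtx m → Vtx m
  | .ord d => if d = 0 then .ord (M - 1) else if d < M then .ord (d - 1) else .ord d
  | v => v

/-- a token moves from `ord 0` to depth `l` of slot `i`. -/
def Xm (i : Fin m) (l : ℕ) : Vtx m → Vtx m
  | .ord d => if d = 0 then (if l = 0 then .root else .slot i (l - 1)) else .ord d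
  | .root => .ord 0
  | .slot i' d => if i' = i ∧ d < l then (if d = 0 then .root else .slot i' (d - 1))
      else .slot i' d
  | .nook i' => .nook i'

theorem exists_D (len : Fin m → ℕ) (N k : ℕ) (i : Fin m) (h : ℕ) (hl : h ≤ len i) :
    ∃ σ : List (Vtx m × Vtx m), (∀ e ∈ σ, (Tree len N k).Adj e.1 e.2) ∧
      σ.length = h ∧ ∀ v, run σ v = Dm i h v := by
  induction h with
  | zero =>
    refine ⟨[], by simp, rfl, ?_⟩
    intro v
    cases v <;> simp [Dm, run]
  | succ h ih =>
    obtain ⟨σ, h1, h2, h3⟩ := ih (by omega)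
    rcases Nat.eq_zero_or_pos h with rfl | hh
    · refine ⟨σ ++ [(.root, .slot i 0)], ?_, by simp [h2], ?_⟩
      · intro e he
        rcases List.mem_append.1 he with he | he
        · exact h1 e he
        · simp only [List.mem_singleton] at he
          subst he
          simp [Tree, SimpleGraph.fromRel_adj, rel]
          omega
      · intro v
        rw [run_append, h3, run_single]
        cases v <;> simp only [Dm, swapV] <;> grind
    · refine ⟨σ ++ [(.slot i (h - 1), .slot i h)], ?_, by simp [h2], ?_⟩
      · intro e he
        rcases List.mem_append.1 he with he | he
        · exact h1 e he
        · simp only [List.mem_singleton] at he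
          subst he
          simp [Tree, SimpleGraph.fromRel_adj, rel]
          omega
      · intro v
        rw [run_append, h3, run_single]
        cases v <;> simp only [Dm, swapV] <;> grind

theorem exists_Y (len : Fin m → ℕ) (N k : ℕ) (h : ℕ) (hl : h + 1 ≤ N) :
    ∃ σ : List (Vtx m × Vtx m), (∀ e ∈ σ, (Tree len N k).Adj e.1 e.2) ∧
      σ.length = h ∧ ∀ v, run σ v = Ym (h + 1) v := by
  induction h with
  | zero =>
    refine ⟨[], by simp, rfl, ?_⟩
    intro v
    cases v <;> simp only [Ym, run, List.foldl_nil] <;> grind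
  | succ h ih =>
    obtain ⟨σ, h1, h2, h3⟩ := ih (by omega)
    refine ⟨σ ++ [(.ord h, .ord (h + 1))], ?_, by simp [h2], ?_⟩
    · intro e he
      rcases List.mem_append.1 he with he | he
      · exact h1 e he
      · simp only [List.mem_singleton] at he
        subst he
        simp [Tree, SimpleGraph.fromRel_adj, rel]
        omega
    · intro v
      rw [run_append, h3, run_single]
      cases v <;> simp only [Ym, swapV] <;> grind

theorem exists_X (len : Fin m → ℕ) (N k : ℕ) (i : Fin m) (h : ℕ) (hl : h ≤ len i)
    (hN : 0 < N) :
    ∃ σ : List (Vtx m × Vtx m), (∀ e ∈ σ, (Tree len N k).Adj e.1 e.2) ∧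
      σ.length = h + 1 ∧ ∀ v, run σ v = Xm i h v := by
  obtain ⟨σ, h1, h2, h3⟩ := exists_D len N k i h hl
  refine ⟨[(.ord 0, .root)] ++ σ, ?_, by simp [h2], ?_⟩
  · intro e he
    rcases List.mem_append.1 he with he | he
    · simp only [List.mem_singleton] at he
      subst he
      simp [Tree, SimpleGraph.fromRel_adj, rel]
      omega
    · exact h1 e he
  · intro v
    rw [run_append, h3, run_single]
    cases v <;> simp only [Dm, Xm, swapV] <;> grind

/-! ### The abstract process -/

/-- number of exchanges with slot `i` before time `t`. -/
def rr (c : ℕ → Fin m) (t : ℕ) (i : Fin m) : ℕ := Nat.count (fun v => c v = i) t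

theorem rr_succ (c : ℕ → Fin m) (t : ℕ) (i : Fin m) :
    rr c (t + 1) i = rr c t i + if c t = i then 1 else 0 := by
  simp [rr, Nat.count_succ]

theorem rr_mono (c : ℕ → Fin m) {t u : ℕ} (h : t ≤ u) (i : Fin m) : rr c t i ≤ rr c u i :=
  Nat.count_monotone _ h

def itemV : Option (Fin m) → Vtx m
  | none => .root
  | some i => .nook i

def posX (N : ℕ) (c : ℕ → Fin m) (t u : ℕ) : Vtx m :=
  if u < t then .slot (c u) (rr c N (c u) - 1 - rr c u (c u)) else .ord (u - t)

def posY (N : ℕ) (c : ℕ → Fin m) (t u : ℕ) : Vtx m :=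
  if u < t then .ord (N - 1 - u) else .slot (c u) (rr c u (c u) - rr c t (c u))

/-- cost of exchange `u`. -/
def cst (N : ℕ) (c : ℕ → Fin m) (u : ℕ) : ℕ := N - u + (rr c N (c u) - rr c u (c u))

/-- state reached at time `t`, with the item at depth `h` of slot `i`. -/
def Reached (N k : ℕ) (c : ℕ → Fin m) (t : ℕ) (i : Fin m) (h : ℕ)
    (g : Option (Fin m) → Option (Fin m)) (b : ℕ) : Prop :=
  ∃ σ : List (Vtx m × Vtx m),
    (∀ e ∈ σ, (Tree (rr c N) N k).Adj e.1 e.2) ∧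
    σ.length ≤ b ∧
    (∀ u < N, run σ (.ord u) = Dm i h (posX N c t u)) ∧
    (∀ u < N, run σ (.slot (c u) (rr c u (c u))) = Dm i h (posY N c t u)) ∧
    (∀ o, run σ (itemV o) = Dm i h (itemV (g o)))

theorem Dm_zero (i : Fin m) (v : Vtx m) : Dm i 0 v = v := by
  cases v <;> simp [Dm]

theorem Reached.change {N k : ℕ} {c : ℕ → Fin m} {t : ℕ} {i : Fin m}
    {g : Option (Fin m) → Option (Fin m)} {b : ℕ} (H : Reached N k c t i 0 g b) (i' : Fin m) :
    Reached N k c t i' 0 g b := by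
  simpa [Reached, Dm_zero] using H

theorem Reached.mono {N k : ℕ} {c : ℕ → Fin m} {t : ℕ} {i : Fin m} {h : ℕ}
    {g : Option (Fin m) → Option (Fin m)} {b b' : ℕ} (H : Reached N k c t i h g b)
    (hb : b ≤ b') : Reached N k c t i h g b' := by
  obtain ⟨σ, h1, h2, h3⟩ := H
  exact ⟨σ, h1, h2.trans hb, h3⟩

theorem Reached.down {N k : ℕ} {c : ℕ → Fin m} {t : ℕ} {i : Fin m} {h : ℕ}
    {g : Option (Fin m) → Option (Fin m)} {b : ℕ} (H : Reached N k c t i 0 g b)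
    (hh : h ≤ rr c N i) : Reached N k c t i h g (b + h) := by
  obtain ⟨σ, h1, h2, h3, h4, h5⟩ := H
  obtain ⟨τ, k1, k2, k3⟩ := exists_D (rr c N) N k i h hh
  refine ⟨σ ++ τ, ?_, by simp; omega, ?_, ?_, ?_⟩
  · intro e he
    rcases List.mem_append.1 he with he | he
    exacts [h1 e he, k1 e he]
  · intro u hu; rw [run_append, h3 u hu, k3, Dm_zero]
  · intro u hu; rw [run_append, h4 u hu, k3, Dm_zero]
  · intro o; rw [run_append, h5, k3, Dm_zero]

theorem Reached.exch {N k : ℕ} {c : ℕ → Fin m} {t : ℕ} {i : Fin m} {h : ℕ}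
    {g : Option (Fin m) → Option (Fin m)} {b : ℕ} (H : Reached N k c t i (h + 1) g b)
    (ht : t < N) (hc : c t = i) (hh : rr c t i + h + 1 ≤ rr c N i) :
    Reached N k c (t + 1) i h g (b + cst N c t) := by
  obtain ⟨σ, h1, h2, h3, h4, h5⟩ := H
  obtain ⟨τ, k1, k2, k3⟩ := exists_X (rr c N) N k i (rr c N i - rr c t i) (by omega) (by omega)
  obtain ⟨υ, l1, l2, l3⟩ := exists_Y (rr c N) N k (N - t - 1) (by omega)
  have e1 : ∀ v, run (σ ++ (τ ++ υ)) v = Ym (N - t) (Xm i (rr c N i - rr c t i) (run σ v)) := by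
    intro v
    rw [run_append, run_append, k3, l3]
    congr 1; omega
  have key : ∀ u, rr c (t + 1) u = rr c t u + if c t = u then 1 else 0 := rr_succ c t
  refine ⟨σ ++ (τ ++ υ), ?_, ?_, ?_, ?_, ?_⟩
  · intro e he
    rcases List.mem_append.1 he with he | he
    · exact h1 e he
    rcases List.mem_append.1 he with he | he
    exacts [k1 e he, l1 e he]
  · simp only [List.length_append, cst, hc]; omega
  · intro u hu
    rw [e1, h3 u hu]
    have a1 : rr c u (c u) + 1 ≤ rr c N (c u) := by
      have := rr_mono c (show u + 1 ≤ N by omega) (c u)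
      rw [rr_succ] at this; simpa using this
    have a2 : u < t → rr c u (c u) + 1 ≤ rr c t (c u) := by
      intro hut
      have := rr_mono c (show u + 1 ≤ t by omega) (c u)
      rw [rr_succ] at this; simpa using this
    unfold posX
    rcases lt_trichotomy u t with hut | rfl | hut
    · rw [if_pos hut, if_pos (by omega)]
      have := a2 hut
      simp only [Dm]
      by_cases hi : c u = i
      · rw [hi] at this a1 ⊢
        grind [Dm, Xm, Ym]
      · grind [Dm, Xm, Ym]
    · rw [if_neg (by omega), if_pos (by omega)]
      grind [Dm, Xm, Ym]
    · rw [if_neg (by omega), if_neg (by omega)]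
      grind [Dm, Xm, Ym]
  · intro u hu
    rw [e1, h4 u hu]
    have a1 : rr c u (c u) + 1 ≤ rr c N (c u) := by
      have := rr_mono c (show u + 1 ≤ N by omega) (c u)
      rw [rr_succ] at this; simpa using this
    have a2 : t < u → rr c (t + 1) (c u) ≤ rr c u (c u) := by
      intro hut
      exact rr_mono c (show t + 1 ≤ u by omega) (c u)
    unfold posY
    rcases lt_trichotomy u t with hut | rfl | hut
    · rw [if_pos hut, if_pos (by omega)]
      grind [Dm, Xm, Ym]
    · rw [if_neg (by omega), if_pos (by omega)]
      grind [Dm, Xm, Ym]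
    · rw [if_neg (by omega), if_neg (by omega)]
      have := a2 hut
      rw [key] at this ⊢
      by_cases hi : c u = i
      · rw [hi] at this a1 ⊢
        rw [if_pos hc] at this ⊢
        grind [Dm, Xm, Ym]
      · rw [if_neg (by rw [hc]; exact fun h => hi h.symm)] at this ⊢
        grind [Dm, Xm, Ym]
  · intro o
    rw [e1, h5]
    cases hgo : g o <;> grind [Dm, Xm, Ym, itemV]

theorem Reached.exchs {N k : ℕ} {c : ℕ → Fin m} {i : Fin m} {h : ℕ}
    {g : Option (Fin m) → Option (Fin m)} : ∀ {t b : ℕ}, Reached N k c t i h g b →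
    t + h ≤ N → (∀ u, t ≤ u → u < t + h → c u = i) →
    Reached N k c (t + h) i 0 g (b + ∑ u ∈ Finset.Ico t (t + h), cst N c u) := by
  induction h with
  | zero => intro t b H _ _; simpa using H
  | succ h ih =>
    intro t b H ht hc
    have hr : ∀ w, w ≤ h + 1 → rr c (t + w) i = rr c t i + w := by
      intro w
      induction w with
      | zero => simp
      | succ w ihw =>
        intro hw
        rw [← add_assoc, rr_succ, ihw (by omega), if_pos (hc _ (by omega) (by omega))]
        omega
    have := H.exch (by omega) (hc t le_rfl (by omega)) (by
      have h1 := hr (h + 1) le_rfl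
      have h2 := rr_mono c ht i
      omega)
    have := ih this (by omega) (fun u h1 h2 => hc u (by omega) (by omega))
    rw [show t + (h + 1) = t + 1 + h by omega, Finset.sum_eq_sum_Ico_succ_bot (by omega),
      ← add_assoc]
    exact this

theorem Reached.single {N k : ℕ} {c : ℕ → Fin m} {t : ℕ} {i : Fin m}
    {g : Option (Fin m) → Option (Fin m)} {b : ℕ} (H : Reached N k c t i 0 g b)
    (ht : t < N) : Reached N k c (t + 1) i 0 g (b + (cst N c t + 1)) := by
  have a1 : rr c t (c t) + 1 ≤ rr c N (c t) := by
    have := rr_mono c (show t + 1 ≤ N by omega) (c t)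
    rw [rr_succ] at this; simpa using this
  have := ((H.change (c t)).down (h := 1) (by omega)).exch ht rfl (by omega)
  exact (this.change i).mono (by omega)

theorem Reached.singles {N k : ℕ} {c : ℕ → Fin m} {i : Fin m}
    {g : Option (Fin m) → Option (Fin m)} {t b : ℕ} (H : Reached N k c t i 0 g b) (w : ℕ)
    (ht : t + w ≤ N) :
    Reached N k c (t + w) i 0 g (b + ∑ u ∈ Finset.Ico t (t + w), (cst N c u + 1)) := by
  induction w with
  | zero => simpa using H
  | succ w ih =>
    rw [← add_assoc, Finset.sum_Ico_succ_top (by omega), ← add_assoc]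
    exact (ih (by omega)).single (by omega)

/-- block exchange with nook swap. -/
theorem Reached.block {N k : ℕ} {c : ℕ → Fin m} {i i' : Fin m}
    {g : Option (Fin m) → Option (Fin m)} {t b : ℕ} (H : Reached N k c t i' 0 g b)
    (hk : 0 < k) (ht : t + k ≤ N) (hc : ∀ u, t ≤ u → u < t + k → c u = i)
    (hL : k ≤ rr c N i) :
    Reached N k c (t + k) i' 0 (fun o => swapV (none, some i) (g o))
      (b + 1 + ∑ u ∈ Finset.Ico t (t + k), (cst N c u + 1)) := by
  have H1 := (H.change i).down hL
  have H2 : Reached N k c t i k (fun o => swapV (none, some i) (g o)) (b + k + 1) := by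
    obtain ⟨σ, h1, h2, h3, h4, h5⟩ := H1
    have e1 : ∀ v, run (σ ++ [(.slot i (k - 1), .nook i)]) v =
        swapV (.slot i (k - 1), .nook i) (run σ v) := by
      intro v
      rw [run_append, run_single]
    refine ⟨σ ++ [(.slot i (k - 1), .nook i)], ?_, by simp; omega, ?_, ?_, ?_⟩
    · intro e he
      rcases List.mem_append.1 he with he | he
      · exact h1 e he
      · simp only [List.mem_singleton] at he
        subst he
        simp [Tree, SimpleGraph.fromRel_adj, rel]
        omega
    · intro u hu
      rw [e1, h3 u hu, posX]
      grind [Dm, swapV]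
    · intro u hu
      rw [e1, h4 u hu, posY]
      grind [Dm, swapV]
    · intro o
      rw [e1, h5]
      cases hgo : g o <;> grind [Dm, swapV, itemV]
  refine ((H2.exchs ht hc).change i').mono ?_
  rw [Finset.sum_add_distrib]
  simp
  omega

theorem reached_zero (N k : ℕ) (c : ℕ → Fin m) (i : Fin m) : Reached N k c 0 i 0 id 0 := by
  refine ⟨[], by simp, by simp, ?_, ?_, ?_⟩ <;> intros <;> simp [run, Dm_zero, posX, posY, rr]

theorem sum_f (c : ℕ → Fin m) (f : Fin m → ℕ) (T : ℕ) :
    ∑ u ∈ Finset.range T, f (c u) = ∑ i, f i * rr c T i := by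
  induction T with
  | zero => simp [rr]
  | succ T ih => simp [Finset.sum_range_succ, ih, rr_succ, mul_add, Finset.sum_add_distrib]

theorem sum_r (c : ℕ → Fin m) (T : ℕ) :
    ∑ u ∈ Finset.range T, (2 * rr c u (c u) + 1) = ∑ i, rr c T i * rr c T i := by
  induction T with
  | zero => simp [rr]
  | succ T ih =>
    rw [Finset.sum_range_succ, ih]
    have : ∀ i, rr c (T + 1) i * rr c (T + 1) i =
        rr c T i * rr c T i + if c T = i then 2 * rr c T i + 1 else 0 := by
      intro i; rw [rr_succ]; split_ifs <;> ring
    simp [this, Finset.sum_add_distrib]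

theorem sum_cst (N : ℕ) (c : ℕ → Fin m) :
    2 * ∑ u ∈ Finset.range N, (cst N c u + 1) =
      ∑ u ∈ Finset.range N, (N + rr c N (c u) + 4) := by
  have hA : ∑ u ∈ Finset.range N, (2 * u + 1) = N * N := by
    induction N with
    | zero => simp
    | succ N ih => rw [Finset.sum_range_succ, ih]; ring
  have hB := sum_r c N
  have hC := sum_f c (rr c N) N
  have : ∑ u ∈ Finset.range N, (2 * (cst N c u + 1)) + ∑ u ∈ Finset.range N, (2 * u + 1) +
      ∑ u ∈ Finset.range N, (2 * rr c u (c u) + 1) =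
      ∑ u ∈ Finset.range N, (N + rr c N (c u) + 4) + ∑ u ∈ Finset.range N, N +
      ∑ u ∈ Finset.range N, rr c N (c u) := by
    simp only [← Finset.sum_add_distrib]
    refine Finset.sum_congr rfl fun u hu => ?_
    have hu := Finset.mem_range.1 hu
    have := rr_mono c hu.le (c u)
    simp only [cst]; omega
  rw [Finset.mul_sum]
  simp only [Finset.sum_const, Finset.card_range, smul_eq_mul] at this
  omega

/-! ### Distances -/

def sg : Vtx m → ℤ → ℤ
  | .root, _ => 0
  | .ord d, _ => -((d : ℤ) + 1)
  | .slot _ d, _ => d + 1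
  | .nook _, k => k + 1

theorem sg_adj (len : Fin m → ℕ) (N k : ℕ) {u v : Vtx m} (h : (Tree len N k).Adj u v) :
    |sg v k - sg u k| ≤ 1 := by
  rw [Tree, SimpleGraph.fromRel_adj] at h
  rw [abs_le]
  obtain ⟨-, h | h⟩ := h <;> cases u <;> cases v <;> simp only [rel, sg] at * <;> omega

theorem sg_walk (len : Fin m → ℕ) (N k : ℕ) {u v : Vtx m} (p : (Tree len N k).Walk u v) :
    |sg v k - sg u k| ≤ p.length := by
  induction p with
  | nil => simp
  | cons h p ih =>
    have := sg_adj len N k h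
    rw [SimpleGraph.Walk.length_cons]
    push_cast
    rw [abs_le] at *
    omega

theorem sg_dist (len : Fin m → ℕ) (N k : ℕ) {u v : Vtx m} (h : (Tree len N k).Reachable u v) :
    |sg v k - sg u k| ≤ (Tree len N k).dist u v := by
  obtain ⟨p, hp⟩ := h.exists_walk_length_eq_dist
  rw [← hp]
  exact sg_walk len N k p

theorem reach_ord (len : Fin m → ℕ) (N k d : ℕ) (h : d < N) :
    (Tree len N k).Reachable .root (.ord d) := by
  induction d with
  | zero =>
    refine SimpleGraph.Adj.reachable ?_
    simp [Tree, SimpleGraph.fromRel_adj, rel, h]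
  | succ d ih =>
    refine (ih (by omega)).trans (SimpleGraph.Adj.reachable ?_)
    simp [Tree, SimpleGraph.fromRel_adj, rel, h]

theorem reach_slot (len : Fin m → ℕ) (N k : ℕ) (i : Fin m) (d : ℕ) (h : d < len i) :
    (Tree len N k).Reachable .root (.slot i d) := by
  induction d with
  | zero =>
    refine SimpleGraph.Adj.reachable ?_
    simp [Tree, SimpleGraph.fromRel_adj, rel, h]
  | succ d ih =>
    refine (ih (by omega)).trans (SimpleGraph.Adj.reachable ?_)
    simp [Tree, SimpleGraph.fromRel_adj, rel, h]

theorem dist_ge (len : Fin m → ℕ) (N k : ℕ) (i : Fin m) (d e : ℕ) (h : d < len i) (h' : e < N) :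
    e + d + 2 ≤ (Tree len N k).dist (.ord e) (.slot i d) := by
  have := sg_dist len N k ((reach_ord len N k e h').symm.trans (reach_slot len N k i d h))
  rw [abs_le] at this
  simp only [sg] at this
  omega

/-! ### The concrete word -/

theorem nxt_ne (s : Fin n → Fin m)
    (hcons : ∀ (j : Fin n) (h : j.val + 1 < n), s j ≠ s ⟨j.val + 1, h⟩) (j : Fin n) :
    some (s j) ≠ nxt s j := by
  unfold nxt
  split_ifs with h
  · exact fun h' => hcons j h (Option.some.inj h')
  · simp

theorem rho_other_lt (s : Fin n → Fin m) (j : Fin n) (hne : some (s j) ≠ nxt s j) (i : Fin m)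
    (h1 : some i ≠ nxt s j) (h2 : i ≠ s j) : rho s i j + 1 < m := by
  unfold rho
  rw [if_neg h1, if_neg h2]
  set A := (Finset.univ.filter fun i' : Fin m =>
      i'.val < i.val ∧ i' ≠ s j ∧ some i' ≠ nxt s j) with hA
  have hi : i ∉ A := by simp [hA]
  have hs : s j ∉ insert i A := by simp [hA, Ne.symm h2]
  cases hn : nxt s j with
  | none =>
    have := Finset.card_le_univ (insert (s j) (insert i A))
    rw [Finset.card_insert_of_notMem hs, Finset.card_insert_of_notMem hi, Fintype.card_fin] at this
    simp
    omega
  | some e =>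
    rw [hn] at hne h1
    have he : e ∉ insert (s j) (insert i A) := by
      simp only [Finset.mem_insert, hA, hn]
      simp
      constructor
      · exact fun h => hne (by rw [h])
      · exact fun h => h1 (by rw [h])
    have := Finset.card_le_univ (insert e (insert (s j) (insert i A)))
    rw [Finset.card_insert_of_notMem he, Finset.card_insert_of_notMem hs,
      Finset.card_insert_of_notMem hi, Fintype.card_fin] at this
    simp
    omega

theorem rho_lt (s : Fin n → Fin m) (j : Fin n) (hne : some (s j) ≠ nxt s j) (i : Fin m) :
    rho s i j < m := by
  have hm := i.2
  by_cases h1 : some i = nxt s j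
  · rw [rho, if_pos h1]; omega
  by_cases h2 : i = s j
  · rw [rho, if_neg h1, if_pos h2]; omega
  have := rho_other_lt s j hne i h1 h2
  omega

theorem rho_other_ne (s : Fin n → Fin m) (j : Fin n) (i i' : Fin m) (hlt : i < i')
    (h1 : some i ≠ nxt s j) (h2 : i ≠ s j)
    (h1' : some i' ≠ nxt s j) (h2' : i' ≠ s j) : rho s i j < rho s i' j := by
  unfold rho
  rw [if_neg h1, if_neg h2, if_neg h1', if_neg h2']
  refine Nat.add_lt_add_left (Finset.card_lt_card ?_) _
  rw [Finset.ssubset_iff_of_subset]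
  · exact ⟨i, by simp [h1, h2, hlt], by simp⟩
  · intro x hx
    simp only [Finset.mem_filter, Finset.mem_univ, true_and] at hx ⊢
    exact ⟨hx.1.trans hlt, hx.2⟩

theorem rho_inj (s : Fin n → Fin m) (j : Fin n) (hne : some (s j) ≠ nxt s j) {i i' : Fin m}
    (h : rho s i j = rho s i' j) : i = i' := by
  have v0 : ∀ i : Fin m, some i = nxt s j → rho s i j = 0 := fun i hi => by rw [rho, if_pos hi]
  have v1 : ∀ i : Fin m, i = s j → rho s i j = m - 1 := fun i hi => by
    rw [rho, if_neg (by rw [hi]; exact hne), if_pos hi]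
  have two : ∀ i : Fin m, some i = nxt s j → 1 < m := by
    intro i hi
    have : i ≠ s j := fun h => hne (by rw [← h, hi])
    have h1 := i.2
    have h2 := (s j).2
    have h3 : i.val ≠ (s j).val := fun h => this (Fin.ext h)
    omega
  have pos : ∀ e i : Fin m, some e = nxt s j → some i ≠ nxt s j → 0 < rho s i j := by
    intro e i he hi
    have := two e he
    by_cases h2 : i = s j
    · rw [v1 i h2]; omega
    · rw [rho, if_neg hi, if_neg h2, ← he]; simp
  by_cases a1 : some i = nxt s j
  · by_cases b1 : some i' = nxt s j
    · exact Option.some.inj (a1.trans b1.symm)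
    · have := pos i i' a1 b1
      have := v0 i a1
      omega
  · by_cases b1 : some i' = nxt s j
    · have := pos i' i b1 a1
      have := v0 i' b1
      omega
    · by_cases a2 : i = s j <;> by_cases b2 : i' = s j
      · rw [a2, b2]
      · have := rho_other_lt s j hne i' b1 b2
        have := v1 i a2
        omega
      · have := rho_other_lt s j hne i a1 a2
        have := v1 i' b2
        omega
      · rcases lt_trichotomy i i' with hl | hl | hl
        · have := rho_other_ne s j i i' hl a1 a2 b1 b2
          omega
        · exact hl
        · have := rho_other_ne s j i' i hl b1 b2 a1 a2
          omega

theorem rho_surj (s : Fin n → Fin m) (j : Fin n) (hne : some (s j) ≠ nxt s j) (ρ : ℕ)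
    (hρ : ρ < m) : ∃ i, rho s i j = ρ := by
  let f : Fin m → Fin m := fun i => ⟨rho s i j, rho_lt s j hne i⟩
  have hf : Function.Injective f := fun a b hab => rho_inj s j hne (Fin.mk.inj_iff.1 hab)
  obtain ⟨i, hi⟩ := (Finite.injective_iff_surjective.1 hf) ⟨ρ, hρ⟩
  exact ⟨i, congrArg Fin.val hi⟩

abbrev ZZ (m n : ℕ) := (Fin n × Fin (kk m n)) ⊕ (Fin m × Fin n × Fin (kk' m n))

def BB (m n : ℕ) : ℕ := kk m n + m * kk' m n

def ph (s : Fin n → Fin m) : ZZ m n → ℕ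
  | Sum.inl (j, a) => j.val * BB m n + a.val
  | Sum.inr (i, j, a) => j.val * BB m n + kk m n + rho s i j * kk' m n + a.val

def sl (s : Fin n → Fin m) : ZZ m n → Fin m
  | Sum.inl (j, _) => s j
  | Sum.inr (i, _, _) => i

theorem euclid {B j j' r r' : ℕ} (hr : r < B) (hr' : r' < B) (h : j * B + r = j' * B + r') :
    j = j' ∧ r = r' := by
  have h1 : (j * B + r) / B = j := by
    rw [mul_comm, Nat.mul_add_div (by omega), Nat.div_eq_of_lt hr, add_zero]
  have h2 : (j' * B + r') / B = j' := by
    rw [mul_comm, Nat.mul_add_div (by omega), Nat.div_eq_of_lt hr', add_zero]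
  have : j = j' := by rw [← h1, ← h2, h]
  subst this
  exact ⟨rfl, by omega⟩

theorem mul_add_lt {a b r B : ℕ} (h : a < b) (hr : r < B) : a * B + r < b * B := by
  have : (a + 1) * B ≤ b * B := Nat.mul_le_mul_right _ h
  rw [add_mul, one_mul] at this
  omega

theorem rem_lt (s : Fin n → Fin m) (hne : ∀ j, some (s j) ≠ nxt s j) (i : Fin m) (j : Fin n)
    (a : Fin (kk' m n)) : kk m n + (rho s i j * kk' m n + a.val) < BB m n := by
  have := mul_add_lt (rho_lt s j (hne j) i) a.2
  unfold BB
  omega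

theorem ph_lt (s : Fin n → Fin m) (hne : ∀ j, some (s j) ≠ nxt s j) (z : ZZ m n) :
    ph s z < n * BB m n := by
  rcases z with ⟨j, a⟩ | ⟨i, j, a⟩
  · exact mul_add_lt j.2 (lt_of_lt_of_le a.2 (Nat.le_add_right _ _))
  · have := mul_add_lt j.2 (rem_lt s hne i j a)
    simp only [ph]
    omega

theorem ph_inj (s : Fin n → Fin m) (hne : ∀ j, some (s j) ≠ nxt s j) :
    Function.Injective (ph s) := by
  have hx : ∀ a : Fin (kk m n), a.val < BB m n :=
    fun a => lt_of_lt_of_le a.2 (Nat.le_add_right _ _)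
  rintro (⟨j, a⟩ | ⟨i, j, a⟩) (⟨j', a'⟩ | ⟨i', j', a'⟩) h <;> simp only [ph] at h
  · obtain ⟨h1, h2⟩ := euclid (hx a) (hx a') h
    rw [Fin.ext h1, Fin.ext h2]
  · have := (euclid (j := j.val) (j' := j'.val) (hx a) (rem_lt s hne i' j' a') (by omega)).2
    have := a.2
    omega
  · have := (euclid (j := j.val) (j' := j'.val) (rem_lt s hne i j a) (hx a') (by omega)).2
    have := a'.2
    omega
  · obtain ⟨h1, h2⟩ := euclid (j := j.val) (j' := j'.val) (rem_lt s hne i j a) (rem_lt s hne i' j' a') (by omega)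
    have hj := Fin.ext h1
    subst hj
    obtain ⟨h3, h4⟩ := euclid a.2 a'.2 (by omega : rho s i j * kk' m n + a = rho s i' j * kk' m n + a')
    rw [rho_inj s j (hne j) h3, Fin.ext h4]

theorem sum_ph (s : Fin n → Fin m) (hne : ∀ j, some (s j) ≠ nxt s j) (f : ℕ → ℕ) :
    ∑ z, f (ph s z) = ∑ u ∈ Finset.range (n * BB m n), f u := by
  have : Finset.univ.image (ph s) = Finset.range (n * BB m n) := by
    refine Finset.eq_of_subset_of_card_le ?_ ?_
    · intro u hu
      obtain ⟨z, -, rfl⟩ := Finset.mem_image.1 hu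
      exact Finset.mem_range.2 (ph_lt s hne z)
    · rw [Finset.card_image_of_injective _ (ph_inj s hne)]
      simp [BB]
      apply le_of_eq
      ring
  rw [← this, Finset.sum_image (fun a _ b _ h => ph_inj s hne h)]

noncomputable def cc (s : Fin n → Fin m) (i0 : Fin m) : ℕ → Fin m :=
  Function.extend (ph s) (sl s) (fun _ => i0)

theorem cc_ph (s : Fin n → Fin m) (hne : ∀ j, some (s j) ≠ nxt s j) (i0 : Fin m) (z : ZZ m n) :
    cc s i0 (ph s z) = sl s z :=
  (ph_inj s hne).extend_apply _ _ _

theorem rr_const (c : ℕ → Fin m) (t w : ℕ) (i' i : Fin m) (h : ∀ a < w, c (t + a) = i') :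
    ∀ a ≤ w, rr c (t + a) i = rr c t i + if i' = i then a else 0 := by
  intro a
  induction a with
  | zero => simp
  | succ a ih =>
    intro ha
    rw [← add_assoc, rr_succ, ih (by omega), h a (by omega)]
    split_ifs <;> omega

def offN (s : Fin n → Fin m) (i : Fin m) (j : ℕ) : ℕ :=
  ∑ j' ∈ Finset.univ.filter (fun j' : Fin n => j'.val < j),
    (kk' m n + if s j' = i then kk m n else 0)

theorem offN_succ (s : Fin n → Fin m) (i : Fin m) (j : Fin n) :
    offN s i (j.val + 1) = offN s i j.val + (kk' m n + if s j = i then kk m n else 0) := by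
  have : Finset.univ.filter (fun j' : Fin n => j'.val < j.val + 1) =
      insert j (Finset.univ.filter (fun j' : Fin n => j'.val < j.val)) := by
    ext x
    simp only [Finset.mem_filter, Finset.mem_insert, Finset.mem_univ, true_and, Fin.ext_iff]
    omega
  rw [offN, this, Finset.sum_insert (by simp), add_comm]
  rfl

theorem offN_n (s : Fin n → Fin m) (i : Fin m) : offN s i n = lenSlot s i := by
  rw [offN, Finset.filter_true_of_mem (fun j _ => j.2), Finset.sum_add_distrib,
    ← Finset.sum_filter]
  simp [lenSlot, cnt]
  ring

theorem tOffP_add (s : Fin n → Fin m) (i : Fin m) (j : Fin n) :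
    offQ s i j + tOffP s i j + (kk' m n + if s j = i then kk m n else 0) = lenSlot s i := by
  rw [← offN_n]
  have h1 := offN_succ s i j
  have h2 : offN s i n = offN s i (j.val + 1) + tOffP s i j := by
    unfold offN tOffP
    rw [Finset.filter_true_of_mem (fun j _ => j.2),
      ← Finset.sum_filter_add_sum_filter_not Finset.univ (fun j' : Fin n => j'.val < j.val + 1)]
    congr 2
    ext x
    simp
  have h3 : offN s i j.val = offQ s i j := rfl
  omega

theorem cc_x (s : Fin n → Fin m) (hne : ∀ j, some (s j) ≠ nxt s j) (i0 : Fin m)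
    (j : Fin n) (a : ℕ) (ha : a < kk m n) : cc s i0 (j.val * BB m n + a) = s j :=
  cc_ph s hne i0 (Sum.inl (j, ⟨a, ha⟩))

theorem cc_p (s : Fin n → Fin m) (hne : ∀ j, some (s j) ≠ nxt s j) (i0 : Fin m)
    (i : Fin m) (j : Fin n) (a : ℕ) (ha : a < kk' m n) :
    cc s i0 (j.val * BB m n + kk m n + rho s i j * kk' m n + a) = i :=
  cc_ph s hne i0 (Sum.inr (i, j, ⟨a, ha⟩))

theorem rr_pad (s : Fin n → Fin m) (hne : ∀ j, some (s j) ≠ nxt s j) (i0 : Fin m)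
    (i : Fin m) (j : Fin n) (ρ : ℕ) (hρ : ρ ≤ m) :
    rr (cc s i0) (j.val * BB m n + kk m n + ρ * kk' m n) i =
      rr (cc s i0) (j.val * BB m n + kk m n) i + if rho s i j < ρ then kk' m n else 0 := by
  induction ρ with
  | zero => simp
  | succ ρ ih =>
    obtain ⟨i', rfl⟩ := rho_surj s j (hne j) ρ (by omega)
    rw [add_mul, one_mul, ← add_assoc,
      rr_const (cc s i0) _ (kk' m n) i' i (fun a ha => cc_p s hne i0 i' j a ha) _ le_rfl,
      ih (by omega)]
    by_cases h : i' = i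
    · subst h; simp
    · have : rho s i j ≠ rho s i' j := fun h' => h (rho_inj s j (hne j) h').symm
      rw [if_neg h]
      split_ifs <;> omega

theorem rr_big (s : Fin n → Fin m) (hne : ∀ j, some (s j) ≠ nxt s j) (i0 : Fin m)
    (i : Fin m) (j : ℕ) (hj : j ≤ n) : rr (cc s i0) (j * BB m n) i = offN s i j := by
  induction j with
  | zero => simp [rr, offN]
  | succ j ih =>
    have h1 := rr_pad s hne i0 i ⟨j, hj⟩ m le_rfl
    have h2 := rr_const (cc s i0) (j * BB m n) (kk m n) (s ⟨j, hj⟩) i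
      (fun a ha => cc_x s hne i0 ⟨j, hj⟩ a ha) _ le_rfl
    have h3 := offN_succ s i ⟨j, hj⟩
    have h4 := ih (by omega)
    rw [if_pos (rho_lt s _ (hne _) i)] at h1
    simp only at h1 h3
    rw [show (j + 1) * BB m n = j * BB m n + kk m n + m * kk' m n by unfold BB; ring]
    omega

theorem rr_x (s : Fin n → Fin m) (hne : ∀ j, some (s j) ≠ nxt s j) (i0 : Fin m)
    (j : Fin n) (a : Fin (kk m n)) :
    rr (cc s i0) (j.val * BB m n + a.val) (s j) = offQ s (s j) j + a.val := by
  rw [rr_const (cc s i0) (j * BB m n) (kk m n) (s j) (s j)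
      (fun a ha => cc_x s hne i0 j a ha) _ a.2.le, rr_big s hne i0 _ _ j.2.le, if_pos rfl]
  rfl

theorem rr_p (s : Fin n → Fin m) (hne : ∀ j, some (s j) ≠ nxt s j) (i0 : Fin m)
    (i : Fin m) (j : Fin n) (a : Fin (kk' m n)) :
    rr (cc s i0) (j.val * BB m n + kk m n + rho s i j * kk' m n + a.val) i =
      offQ s i j + (if s j = i then kk m n else 0) + a.val := by
  rw [rr_const (cc s i0) _ (kk' m n) i i
      (fun a ha => cc_p s hne i0 i j a ha) _ a.2.le, if_pos rfl,
    rr_pad s hne i0 i j _ (rho_lt s j (hne j) i).le,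
    rr_const (cc s i0) (j * BB m n) (kk m n) (s j) i
      (fun a ha => cc_x s hne i0 j a ha) _ le_rfl, rr_big s hne i0 _ _ j.2.le]
  simp
  rfl

/-- The number of exchanges preceding the token `z` in its slot. -/
def off (s : Fin n → Fin m) : ZZ m n → ℕ
  | Sum.inl (j, a) => offQ s (s j) j + a.val
  | Sum.inr (i, j, a) => offQ s i j + (if s j = i then kk m n else 0) + a.val

theorem rr_ph (s : Fin n → Fin m) (hne : ∀ j, some (s j) ≠ nxt s j) (i0 : Fin m) (z : ZZ m n) :
    rr (cc s i0) (ph s z) (sl s z) = off s z := by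
  rcases z with ⟨j, a⟩ | ⟨i, j, a⟩
  · exact rr_x s hne i0 j a
  · exact rr_p s hne i0 i j a

theorem off_lt (s : Fin n → Fin m) (z : ZZ m n) : off s z < lenSlot s (sl s z) := by
  rcases z with ⟨j, a⟩ | ⟨i, j, a⟩
  · have := tOffP_add s (s j) j
    have := a.2
    simp only [off, sl]
    rw [if_pos rfl] at *
    omega
  · have := tOffP_add s i j
    have := a.2
    simp only [off, sl]
    omega

def tokX : ZZ m n → Tok m n
  | Sum.inl z => Sum.inr (Sum.inl z)
  | Sum.inr z => Sum.inr (Sum.inr (Sum.inr (Sum.inl z)))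

def tokY : ZZ m n → Tok m n
  | Sum.inl z => Sum.inr (Sum.inr (Sum.inl z))
  | Sum.inr z => Sum.inr (Sum.inr (Sum.inr (Sum.inr z)))

theorem lenOrd_eq : lenOrd m n = n * BB m n := by unfold lenOrd BB; ring

theorem init_X (s : Fin n → Fin m) (z : ZZ m n) : initTok s (tokX z) = .ord (ph s z) := by
  rcases z with ⟨j, a⟩ | ⟨i, j, a⟩ <;> rfl

theorem init_Y (s : Fin n → Fin m) (z : ZZ m n) :
    initTok s (tokY z) = .slot (sl s z) (off s z) := by
  rcases z with ⟨j, a⟩ | ⟨i, j, a⟩ <;> rfl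

theorem tgt_Y (s : Fin n → Fin m) (π : Equiv.Perm (Option (Fin m))) (z : ZZ m n) :
    tgtTok s π (tokY z) = .ord (n * BB m n - 1 - ph s z) := by
  rw [← lenOrd_eq]
  rcases z with ⟨j, a⟩ | ⟨i, j, a⟩ <;> rfl

theorem tgt_X (s : Fin n → Fin m) (π : Equiv.Perm (Option (Fin m))) (z : ZZ m n) :
    tgtTok s π (tokX z) = .slot (sl s z) (lenSlot s (sl s z) - 1 - off s z) := by
  rcases z with ⟨j, a⟩ | ⟨i, j, a⟩
  · simp only [tgtTok, tokX, sl, off]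
    have := tOffP_add s (s j) j
    have := a.2
    rw [if_pos rfl] at *
    congr 1
    omega
  · simp only [tgtTok, tokX, sl, off]
    have := tOffP_add s i j
    have := a.2
    congr 1
    omega

theorem steps (s : Fin n → Fin m) (hne : ∀ j, some (s j) ≠ nxt s j) (i0 : Fin m)
    (hk : 0 < kk m n) :
    ∀ (d j : ℕ), j + d = n → ∀ (g : Option (Fin m) → Option (Fin m)) (σ' : List (Fin m)),
      σ'.Sublist ((List.ofFn s).drop j) →
      Reached (n * BB m n) (kk m n) (cc s i0) (j * BB m n) i0 0 g
        (∑ u ∈ Finset.range (j * BB m n), (cst (n * BB m n) (cc s i0) u + 1) + j) →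
      Reached (n * BB m n) (kk m n) (cc s i0) (n * BB m n) i0 0 (starApply σ' g)
        (∑ u ∈ Finset.range (n * BB m n), (cst (n * BB m n) (cc s i0) u + 1) + n) := by
  intro d
  induction d with
  | zero =>
    intro j hj g σ' hσ H
    obtain rfl : j = n := by omega
    rw [List.drop_of_length_le (by simp)] at hσ
    rw [List.sublist_nil.1 hσ]
    exact H
  | succ d ih =>
    intro j hj g σ' hσ H
    have hjn : j < n := by omega
    have hB : (j + 1) * BB m n ≤ n * BB m n := Nat.mul_le_mul_right _ hjn
    have hB2 : (j + 1) * BB m n = j * BB m n + BB m n := by ring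
    have hB3 : BB m n = kk m n + m * kk' m n := rfl
    rw [List.drop_eq_getElem_cons (by simpa using hjn)] at hσ
    simp only [List.getElem_ofFn] at hσ
    have fin : ∀ b t w : ℕ, ∑ u ∈ Finset.range t, (cst (n * BB m n) (cc s i0) u + 1) + b +
        ∑ u ∈ Finset.Ico t (t + w), (cst (n * BB m n) (cc s i0) u + 1) =
        ∑ u ∈ Finset.range (t + w), (cst (n * BB m n) (cc s i0) u + 1) + b := by
      intro b t w
      rw [← Finset.sum_range_add_sum_Ico _ (show t ≤ t + w by omega)]
      omega
    rcases List.sublist_cons_iff.1 hσ with h | ⟨r, rfl, h⟩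
    · refine ih (j + 1) (by omega) g σ' h ?_
      have := H.singles (BB m n) (by omega)
      rw [fin] at this
      rw [hB2]
      exact this.mono (by omega)
    · refine ih (j + 1) (by omega) (fun o => swapV (none, some (s ⟨j, hjn⟩)) (g o)) r h ?_
      have h1 := H.block (i := s ⟨j, hjn⟩) hk (by omega) (by
        intro u h1 h2
        obtain ⟨a, rfl⟩ := Nat.exists_eq_add_of_le h1
        exact cc_x s hne i0 ⟨j, hjn⟩ a (by omega)) (by
        rw [rr_big s hne i0 _ n le_rfl, offN_n]
        have := tOffP_add s (s ⟨j, hjn⟩) ⟨j, hjn⟩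
        rw [if_pos rfl] at this
        omega)
      rw [add_assoc _ j 1, fin] at h1
      have h2 := h1.singles (m * kk' m n) (by omega)
      rw [fin] at h2
      rw [hB2, hB3, ← add_assoc]
      exact h2
/-!
STATEMENT 3: If the Star STS instance is a YES instance, then the constructed
(unweighted, sequential) token swapping instance has a swap sequence of length at most
`K = H + n` transforming the initial placement into the target placement, where
`H = (1/2)·Σ_{t∈A}(d_t+1)` and `A` is the set of non-item tokens.  The length bound
`σ.length ≤ H + n` is stated in the equivalent doubled form
`2·σ.length ≤ Σ_{t∈A}(d_t+1) + 2n`.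
-/
theorem starSTS_yes_implies_tokenSwapping_yes {m n : ℕ}
    (s : Fin n → Fin m) (π : Equiv.Perm (Option (Fin m)))
    (hπ0 : π none = none)
    (hocc : ∀ i : Fin m, ∃ j, s j = i)
    (hcons : ∀ (j : Fin n) (h : j.val + 1 < n), s j ≠ s ⟨j.val + 1, h⟩)
    (hyes : StarSTSYes π (List.ofFn s)) :
    ∃ σ : List (Vtx m × Vtx m),
      (∀ e ∈ σ, (TheGraph s).Adj e.1 e.2) ∧
      applySwaps σ (initTok s) = tgtTok s π ∧
      2 * σ.length ≤ (∑ t : NonItem m n, (dd s π (Sum.inr t) + 1)) + 2 * n := by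
  classical
  have hne : ∀ j, some (s j) ≠ nxt s j := nxt_ne s hcons
  rcases Nat.eq_zero_or_pos m with rfl | hm
  · obtain rfl : n = 0 := by
      rcases Nat.eq_zero_or_pos n with h | h
      · exact h
      · exact (s ⟨0, h⟩).elim0
    refine ⟨[], by simp, ?_, by simp⟩
    funext t
    rcases t with (_ | i) | ⟨j, a⟩ | ⟨j, a⟩ | ⟨i, j, a⟩ | ⟨i, j, a⟩
    · simp [applySwaps, initTok, tgtTok, hπ0]
    · exact i.elim0
    · exact j.elim0
    · exact j.elim0
    · exact i.elim0
    · exact i.elim0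
  let i0 : Fin m := ⟨0, hm⟩
  have hn : 0 < n := by
    obtain ⟨j, -⟩ := hocc i0
    exact lt_of_le_of_lt (Nat.zero_le _) j.2
  have hk : 0 < kk m n := by unfold kk; positivity
  obtain ⟨σ', hσ', hst⟩ := hyes
  have hR := steps s hne i0 hk n 0 (by omega) id σ' (by simpa using hσ')
    (by simpa using reached_zero _ _ _ _)
  rw [hst] at hR
  obtain ⟨σ, h1, h2, h3, h4, h5⟩ := hR
  have hlen : rr (cc s i0) (n * BB m n) = lenSlot s := by
    funext i
    rw [rr_big s hne i0 i n le_rfl, offN_n]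
  have hG : TheGraph s = Tree (rr (cc s i0) (n * BB m n)) (n * BB m n) (kk m n) := by
    rw [hlen, TheGraph, lenOrd_eq]
  refine ⟨σ, by rw [hG]; exact h1, ?_, ?_⟩
  · rw [applySwaps_eq]
    have hX : ∀ z, run σ (initTok s (tokX z)) = tgtTok s π (tokX z) := by
      intro z
      have hz := ph_lt s hne z
      rw [init_X, tgt_X, h3 _ hz, Dm_zero, posX, if_pos hz, cc_ph s hne, rr_ph s hne, hlen]
    have hY : ∀ z, run σ (initTok s (tokY z)) = tgtTok s π (tokY z) := by
      intro z
      have hz := ph_lt s hne z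
      have := h4 _ hz
      rw [Dm_zero, posY, if_pos hz, cc_ph s hne, rr_ph s hne] at this
      rw [init_Y, tgt_Y, this]
    funext t
    rcases t with o | z | z | z | z
    · have := h5 o
      rw [Dm_zero] at this
      have e1 : initTok s (Sum.inl o) = itemV o := by cases o <;> rfl
      have e2 : tgtTok s π (Sum.inl o) = itemV (π o) := by
        simp only [tgtTok]
        cases π o <;> rfl
      rw [e1, e2, this]
    · exact hX (Sum.inl z)
    · exact hY (Sum.inl z)
    · exact hX (Sum.inr z)
    · exact hY (Sum.inr z)
  · have hsum : ∑ t : NonItem m n, (dd s π (Sum.inr t) + 1) =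
        ∑ z : ZZ m n, ((dd s π (tokX z) + 1) + (dd s π (tokY z) + 1)) := by
      simp only [Fintype.sum_sum_type, tokX, tokY, Finset.sum_add_distrib]
      ring
    have hge : ∑ z : ZZ m n, (n * BB m n + rr (cc s i0) (n * BB m n) (cc s i0 (ph s z)) + 4) ≤
        ∑ z : ZZ m n, ((dd s π (tokX z) + 1) + (dd s π (tokY z) + 1)) := by
      refine Finset.sum_le_sum fun z _ => ?_
      have hz := ph_lt s hne z
      have ho := off_lt s z
      have d1 := dist_ge (lenSlot s) (n * BB m n) (kk m n) (sl s z)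
        (lenSlot s (sl s z) - 1 - off s z) (ph s z) (by omega) hz
      have d2 := dist_ge (lenSlot s) (n * BB m n) (kk m n) (sl s z)
        (off s z) (n * BB m n - 1 - ph s z) ho (by omega)
      rw [SimpleGraph.dist_comm] at d2
      unfold dd
      rw [hG, init_X, init_Y, tgt_X, tgt_Y, cc_ph s hne, hlen]
      omega
    rw [sum_ph s hne (fun u => n * BB m n + rr (cc s i0) (n * BB m n) (cc s i0 u) + 4),
      ← sum_cst] at hge
    rw [hsum]
    omega

end UnweightedTS
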